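/- arXiv:1709.08923 — 2 statements merged into one kernel-verified Lean document; each statement's English description precedes it below -/
import Mathlib

section
/- Fix ν > 0 and 0 < b < c. Let Z be an inverse-gamma random variable and let X be a nonnegative random variable, independent of Z, such that 1 + Z/b and (1 + X/b)(1 + Z/c) have the same distribution. Then for every a > 0, E[(1 + X/b)^{−a}] = (c/b)^{ν} · Ψ(ν+a, ν+1; 1/(2b)) / Ψ(ν+a, ν+1; 1/(2c)). -/
open MeasureTheory ProbabilityTheory Real Set

/-- Kummer's confluent hypergeometric function `Φ(α,β;z)`, via the Euler integral
`Φ(α,β;z) = (Γ(β)/(Γ(α)Γ(β−α))) ∫_0^1 t^{α−1}(1−t)^{β−α−1} e^{zt} dt`. -/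
noncomputable def Phi (α β z : ℝ) : ℝ :=
  (Real.Gamma β / (Real.Gamma α * Real.Gamma (β - α))) *
    ∫ t in Set.Ioo (0:ℝ) 1, t ^ (α - 1) * (1 - t) ^ (β - α - 1) * Real.exp (z * t)

/-- Tricomi's confluent hypergeometric function `Ψ(α,β;z)`, via the integral
`Ψ(α,β;z) = (1/Γ(α)) ∫_0^∞ e^{−zt} t^{α−1} (1+t)^{β−α−1} dt`. -/
noncomputable def Psi (α β z : ℝ) : ℝ :=
  (Real.Gamma α)⁻¹ *
    ∫ t in Set.Ioi (0:ℝ), Real.exp (-(z * t)) * t ^ (α - 1) * (1 + t) ^ (β - α - 1)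

/-- The inverse-gamma law with parameter `ν`: the pushforward of the `Gamma(ν,1)`
distribution under the map `x ↦ 1/(2x)`. -/
noncomputable def invGammaLaw (ν : ℝ) : Measure ℝ :=
  Measure.map (fun x => 1 / (2 * x)) (gammaMeasure ν 1)

lemma measurable_gammaPDF (a r : ℝ) : Measurable (gammaPDF a r) :=
  (measurable_gammaPDFReal a r).ennreal_ofReal

lemma measurable_one_add_div_rpow (b a : ℝ) : Measurable fun z : ℝ => (1 + z / b) ^ (-a) := by
  fun_prop

/-- The inverse-gamma law is carried by the nonnegative reals. -/
lemma ae_nonneg_invGammaLaw (ν : ℝ) : ∀ᵐ z ∂invGammaLaw ν, 0 ≤ z := by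
  have hm : Measurable fun x : ℝ => 1 / (2 * x) := by fun_prop
  rw [invGammaLaw, ae_map_iff hm.aemeasurable measurableSet_Ici, gammaMeasure,
    ae_withDensity_iff (measurable_gammaPDF ν 1)]
  refine ae_of_all _ fun x hx => ?_
  by_contra h
  have hx0 : x < 0 := by
    by_contra hx0
    push Not at hx0
    exact h (by positivity)
  exact hx (gammaPDF_of_neg hx0)

/-- The negative moments of `1 + Z / b` for an inverse-gamma variable `Z`. -/
lemma integral_one_add_div_rpow_invGammaLaw {ν b a : ℝ} (hν : 0 < ν) (hb : 0 < b) (ha : 0 < a) :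
    ∫ z, (1 + z / b) ^ (-a) ∂invGammaLaw ν
      = b ^ (-ν) * ((2 : ℝ) ^ (-ν) * Real.Gamma (ν + a) / Real.Gamma ν) *
          Psi (ν + a) (ν + 1) (1 / (2 * b)) := by
  have hm : Measurable fun x : ℝ => 1 / (2 * x) := by fun_prop
  have hΓ : Real.Gamma (ν + a) ≠ 0 := (Real.Gamma_pos_of_pos (by positivity)).ne'
  have hk : 0 < (2 * b)⁻¹ := by positivity
  rw [invGammaLaw, integral_map hm.aemeasurable
    (measurable_one_add_div_rpow b a).aestronglyMeasurable, gammaMeasure,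
    integral_withDensity_eq_integral_toReal_smul (measurable_gammaPDF ν 1)
      (ae_of_all _ fun x => ENNReal.ofReal_lt_top),
    ← setIntegral_eq_integral_of_forall_compl_eq_zero (s := Ici 0)
      (fun x hx => by
        rw [gammaPDF_of_neg (not_le.mp hx)]
        simp),
    integral_Ici_eq_integral_Ioi]
  have hscale := integral_comp_mul_left_Ioi
    (fun x : ℝ => (gammaPDF ν 1 x).toReal • (1 + 1 / (2 * x) / b) ^ (-a)) 0 hk
  rw [mul_zero, smul_eq_mul, eq_inv_mul_iff_mul_eq₀ hk.ne'] at hscale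
  have hpoint : ∀ t ∈ Ioi (0 : ℝ),
      (gammaPDF ν 1 ((2 * b)⁻¹ * t)).toReal • (1 + 1 / (2 * ((2 * b)⁻¹ * t)) / b) ^ (-a)
        = ((2 * b)⁻¹ ^ (ν - 1) / Real.Gamma ν) *
          (Real.exp (-(1 / (2 * b) * t)) * t ^ (ν + a - 1) * (1 + t) ^ (ν + 1 - (ν + a) - 1)) := by
    intro t ht
    have ht : 0 < t := ht
    have hkt : 0 ≤ (2 * b)⁻¹ * t := by positivity
    have hbase : 1 + 1 / (2 * ((2 * b)⁻¹ * t)) / b = (1 + t) / t := by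
      field_simp
      ring
    have hpow : t ^ (ν + a - 1) = t ^ (ν - 1) * t ^ a := by
      rw [← Real.rpow_add ht]
      ring_nf
    rw [gammaPDF_of_nonneg hkt, ENNReal.toReal_ofReal (by
        have := Real.Gamma_pos_of_pos hν
        positivity), smul_eq_mul, hbase,
      Real.div_rpow (by positivity) ht.le, Real.mul_rpow hk.le ht.le, hpow,
      Real.rpow_neg ht.le, Real.one_rpow, div_inv_eq_mul, one_mul,
      show ν + 1 - (ν + a) - 1 = -a by ring, one_div]
    ring_nf
  rw [← hscale, setIntegral_congr_fun measurableSet_Ioi hpoint, integral_const_mul, Psi]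
  have hconst : (2 * b)⁻¹ * (2 * b)⁻¹ ^ (ν - 1) = b ^ (-ν) * (2 : ℝ) ^ (-ν) := by
    rw [mul_comm, ← Real.rpow_add_one hk.ne', sub_add_cancel, Real.inv_rpow (by positivity),
      ← Real.rpow_neg (by positivity), Real.mul_rpow (by positivity) hb.le, mul_comm]
  rw [← mul_assoc, ← mul_div_assoc, hconst]
  field_simp

lemma integral_one_add_div_rpow_invGammaLaw_pos {ν c a : ℝ} (hν : 0 < ν) (hc : 0 < c)
    (ha : 0 < a) : 0 < ∫ z, (1 + z / c) ^ (-a) ∂invGammaLaw ν := by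
  have : IsProbabilityMeasure (gammaMeasure ν 1) := isProbabilityMeasure_gammaMeasure hν one_pos
  have : IsProbabilityMeasure (invGammaLaw ν) :=
    Measure.isProbabilityMeasure_map (by fun_prop)
  have hpos : ∀ᵐ z ∂invGammaLaw ν, 0 < (1 + z / c) ^ (-a) := by
    filter_upwards [ae_nonneg_invGammaLaw ν] with z hz
    positivity
  have hint : Integrable (fun z => (1 + z / c) ^ (-a)) (invGammaLaw ν) := by
    refine Integrable.of_bound (measurable_one_add_div_rpow c a).aestronglyMeasurable 1 ?_
    filter_upwards [ae_nonneg_invGammaLaw ν] with z hz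
    rw [Real.norm_of_nonneg (by positivity)]
    have : 0 ≤ z / c := by positivity
    exact Real.rpow_le_one_of_one_le_of_nonpos (by linarith) (by linarith)
  have hnonneg : 0 ≤ᵐ[invGammaLaw ν] fun z => (1 + z / c) ^ (-a) := hpos.mono fun z hz => hz.le
  refine lt_of_le_of_ne (integral_nonneg_of_ae hnonneg) fun h => ?_
  have hzero := (integral_eq_zero_iff_of_nonneg_ae hnonneg hint).mp h.symm
  obtain ⟨z, hz, hz'⟩ := (hpos.and hzero).exists
  exact hz.ne' hz'

theorem stmt9 {Ω : Type*} [MeasurableSpace Ω] (P : Measure Ω) [IsProbabilityMeasure P]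
    (ν b c : ℝ) (hν : 0 < ν) (hb : 0 < b) (hbc : b < c)
    (Z X : Ω → ℝ) (hZm : Measurable Z) (hXm : Measurable X)
    (hZ : Measure.map Z P = invGammaLaw ν)
    (hX : ∀ᵐ ω ∂P, 0 ≤ X ω)
    (hind : IndepFun X Z P)
    (hlaw : Measure.map (fun ω => 1 + Z ω / b) P
          = Measure.map (fun ω => (1 + X ω / b) * (1 + Z ω / c)) P) :
    ∀ a : ℝ, 0 < a →
      (∫ ω, (1 + X ω / b) ^ (-a) ∂P)
        = (c / b) ^ ν * Psi (ν + a) (ν + 1) (1 / (2 * b)) /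
            Psi (ν + a) (ν + 1) (1 / (2 * c)) := by
  intro a ha
  have hc : 0 < c := hb.trans hbc
  have hZ0 : ∀ᵐ ω ∂P, 0 ≤ Z ω := by
    refine ae_of_ae_map (p := fun z => 0 ≤ z) hZm.aemeasurable ?_
    rw [hZ]
    exact ae_nonneg_invGammaLaw ν
  have hmoment : ∀ d : ℝ, ∫ ω, (1 + Z ω / d) ^ (-a) ∂P
      = ∫ z, (1 + z / d) ^ (-a) ∂invGammaLaw ν := fun d => by
    rw [← hZ, integral_map hZm.aemeasurable
      (measurable_one_add_div_rpow d a).aestronglyMeasurable]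
  have hpow : Measurable fun x : ℝ => x ^ (-a) := by fun_prop
  have hlaw' : ∫ ω, (1 + Z ω / b) ^ (-a) ∂P
      = ∫ ω, ((1 + X ω / b) * (1 + Z ω / c)) ^ (-a) ∂P := by
    rw [← integral_map (φ := fun ω => 1 + Z ω / b) (f := fun x : ℝ => x ^ (-a))
      (by fun_prop) hpow.aestronglyMeasurable, hlaw,
      integral_map (by fun_prop) hpow.aestronglyMeasurable]
  have hsplit : ∫ ω, ((1 + X ω / b) * (1 + Z ω / c)) ^ (-a) ∂P
      = (∫ ω, (1 + X ω / b) ^ (-a) ∂P) * ∫ ω, (1 + Z ω / c) ^ (-a) ∂P := by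
    have hind' : IndepFun (fun ω => (1 + X ω / b) ^ (-a)) (fun ω => (1 + Z ω / c) ^ (-a)) P :=
      hind.comp (measurable_one_add_div_rpow b a) (measurable_one_add_div_rpow c a)
    rw [← hind'.integral_fun_mul_eq_mul_integral
      ((measurable_one_add_div_rpow b a).comp hXm).aestronglyMeasurable
      ((measurable_one_add_div_rpow c a).comp hZm).aestronglyMeasurable]
    refine integral_congr_ae ?_
    filter_upwards [hX, hZ0] with ω hx hz
    exact Real.mul_rpow (by positivity) (by positivity)
  have hpos := integral_one_add_div_rpow_invGammaLaw_pos hν hc ha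
  rw [hsplit, hmoment, hmoment, integral_one_add_div_rpow_invGammaLaw hν hb ha] at hlaw'
  rw [integral_one_add_div_rpow_invGammaLaw hν hc ha] at hlaw' hpos
  have hPsi : Psi (ν + a) (ν + 1) (1 / (2 * c)) ≠ 0 := right_ne_zero_of_mul hpos.ne'
  have hK : (2 : ℝ) ^ (-ν) * Real.Gamma (ν + a) / Real.Gamma ν ≠ 0 :=
    right_ne_zero_of_mul (left_ne_zero_of_mul hpos.ne')
  have hbν : b ^ ν ≠ 0 := (Real.rpow_pos_of_pos hb ν).ne'
  have hcν : c ^ ν ≠ 0 := (Real.rpow_pos_of_pos hc ν).ne'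
  generalize (2 : ℝ) ^ (-ν) * Real.Gamma (ν + a) / Real.Gamma ν = K at hlaw' hK
  rw [Real.rpow_neg hb.le, Real.rpow_neg hc.le] at hlaw'
  rw [Real.div_rpow hc.le hb.le, eq_div_iff hPsi]
  field_simp at hlaw' ⊢
  linear_combination -hlaw'
end

section
/- Fix ν > 0 and b > c > 0. Let ζ be the inverse-gamma law with parameter ν, and for α > 0 let μ_α be the probability measure on (α,∞) defined by μ_α(dz) = (z−α)^{ν−1} 1_{z>α} ζ(dz) / N_α, where N_α = ∫_{(α,∞)} (z−α)^{ν−1} ζ(dz). Let Z_b, Z_c have laws μ_b, μ_c, and let Y₁, Y₂ be random variables with values in (0,1], each independent of Z_c, such that for i = 1,2 the random variables Z_b/b − 1 and Yᵢ·(Z_c/c − 1) have the same distribution. Then Y₁ and Y₂ have the same distribution. -/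
open MeasureTheory ProbabilityTheory Real Set

/-- The tilted inverse-gamma law `μ_α(dz) = (z−α)^{ν−1} 1_{z>α} ζ(dz) / N_α`, where `ζ`
is the inverse-gamma law with parameter `ν` and `N_α` is the normalizing constant. -/
noncomputable def tiltedInvGamma (ν α : ℝ) : Measure ℝ :=
  ((invGammaLaw ν).withDensity
      (fun z => ENNReal.ofReal (if α < z then (z - α) ^ (ν - 1) else 0)) Set.univ)⁻¹ •
    (invGammaLaw ν).withDensity
      (fun z => ENNReal.ofReal (if α < z then (z - α) ^ (ν - 1) else 0))

/-- The complex moment generating function of a nonpositive random variable is analytic on the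
right half-plane. -/
theorem analyticOnNhd_complexMGF_of_nonpos {Ω : Type*} [MeasurableSpace Ω] {P : Measure Ω}
    [IsFiniteMeasure P] {X : Ω → ℝ} (hX : AEMeasurable X P) (hX0 : ∀ᵐ ω ∂P, X ω ≤ 0) :
    AnalyticOnNhd ℂ (complexMGF X P) {z | 0 < z.re} := by
  refine (analyticOnNhd_complexMGF (X := X) (μ := P)).mono fun z hz => ?_
  have hsub : Ioi (0 : ℝ) ⊆ interior (integrableExpSet X P) := by
    refine interior_maximal (fun t ht => ?_) isOpen_Ioi
    refine Integrable.of_bound (by fun_prop) 1 ?_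
    filter_upwards [hX0] with ω hω
    rw [Real.norm_eq_abs, Real.abs_exp, Real.exp_le_one_iff]
    exact mul_nonpos_of_nonneg_of_nonpos (le_of_lt ht) hω
  exact hsub hz

/-- The complex moment generating function of a nonpositive random variable has the expected
horizontal limits on the imaginary axis. -/
theorem tendsto_complexMGF_of_nonpos {Ω : Type*} [MeasurableSpace Ω] {P : Measure Ω}
    [IsFiniteMeasure P] {X : Ω → ℝ} (hX : AEMeasurable X P) (hX0 : ∀ᵐ ω ∂P, X ω ≤ 0) (t : ℝ) :
    Filter.Tendsto (fun s : ℝ => complexMGF X P (s + t * Complex.I)) (nhdsWithin 0 (Ioi 0))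
      (nhds (complexMGF X P (t * Complex.I))) := by
  unfold complexMGF
  refine tendsto_integral_filter_of_dominated_convergence (fun _ => 1) ?_ ?_
    (integrable_const _) ?_
  · exact Filter.Eventually.of_forall fun s => by fun_prop
  · filter_upwards [self_mem_nhdsWithin] with s hs
    filter_upwards [hX0] with ω hω
    rw [Complex.norm_exp, Real.exp_le_one_iff]
    simp only [Complex.mul_re, Complex.add_re, Complex.ofReal_re, Complex.ofReal_im,
      Complex.I_re, Complex.I_im]
    simpa using mul_nonpos_of_nonneg_of_nonpos (le_of_lt hs) hω
  · refine Filter.Eventually.of_forall fun ω => ?_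
    have hc : Continuous fun s : ℝ => Complex.exp ((s + t * Complex.I) * X ω) := by fun_prop
    simpa using (hc.tendsto 0).mono_left nhdsWithin_le_nhds

/-- Two nonpositive random variables whose moment generating functions agree on a right
neighbourhood of `0` have the same law. -/
theorem map_eq_map_of_mgf_eqOn_Ioo {Ω Ω' : Type*} [MeasurableSpace Ω] [MeasurableSpace Ω']
    {P : Measure Ω} {P' : Measure Ω'} [IsProbabilityMeasure P] [IsProbabilityMeasure P']
    {X : Ω → ℝ} {Y : Ω' → ℝ} (hX : AEMeasurable X P) (hY : AEMeasurable Y P')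
    (hX0 : ∀ᵐ ω ∂P, X ω ≤ 0) (hY0 : ∀ᵐ ω ∂P', Y ω ≤ 0) {δ : ℝ} (hδ : 0 < δ)
    (h : EqOn (mgf X P) (mgf Y P') (Ioo 0 δ)) :
    P.map X = P'.map Y := by
  have hpre : IsPreconnected {z : ℂ | 0 < z.re} :=
    (convex_halfSpace_re_gt 0).isPreconnected
  have hδ2 : ((δ / 2 : ℝ) : ℂ) ∈ {z : ℂ | 0 < z.re} := by
    simp only [mem_ofPred_eq, Complex.ofReal_re]; linarith
  have hfreq : ∃ᶠ z in nhdsWithin ((δ / 2 : ℝ) : ℂ) {((δ / 2 : ℝ) : ℂ)}ᶜ,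
      complexMGF X P z = complexMGF Y P' z := by
    have hev : ∀ᶠ s : ℝ in nhdsWithin (δ / 2) {δ / 2}ᶜ,
        complexMGF X P s = complexMGF Y P' s := by
      filter_upwards [mem_nhdsWithin_of_mem_nhds
        (Ioo_mem_nhds (by linarith : 0 < δ / 2) (by linarith : δ / 2 < δ))] with s hs
      rw [complexMGF_ofReal, complexMGF_ofReal, h hs]
    have ht : Filter.Tendsto (fun s : ℝ => (s : ℂ)) (nhdsWithin (δ / 2) {δ / 2}ᶜ)
        (nhdsWithin ((δ / 2 : ℝ) : ℂ) {((δ / 2 : ℝ) : ℂ)}ᶜ) := by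
      refine (Complex.continuous_ofReal.continuousWithinAt).tendsto_nhdsWithin fun s hs => ?_
      simpa only [mem_compl_iff, mem_singleton_iff, Complex.ofReal_inj] using hs
    exact ht.frequently hev.frequently
  have heq := (analyticOnNhd_complexMGF_of_nonpos hX hX0).eqOn_of_preconnected_of_frequently_eq
    (analyticOnNhd_complexMGF_of_nonpos hY hY0) hpre hδ2 hfreq
  have himag : ∀ t : ℝ, complexMGF X P (t * Complex.I) = complexMGF Y P' (t * Complex.I) := by
    intro t
    refine tendsto_nhds_unique ((tendsto_complexMGF_of_nonpos hX hX0 t).congr' ?_)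
      (tendsto_complexMGF_of_nonpos hY hY0 t)
    filter_upwards [self_mem_nhdsWithin] with s hs
    exact heq (by simpa using hs)
  have := Measure.isProbabilityMeasure_map hX
  have := Measure.isProbabilityMeasure_map hY
  refine Measure.ext_of_charFun (funext fun t => ?_)
  rw [← complexMGF_mul_I hX, ← complexMGF_mul_I hY, himag]

/-- The moment of order `ν - 1 / 2` of the inverse-gamma law with parameter `ν` is finite. -/
theorem lintegral_rpow_invGammaLaw_ne_top {ν : ℝ} (hν : 0 < ν) :
    ∫⁻ z, ENNReal.ofReal (if 0 < z then z ^ (ν - 1 / 2) else 0) ∂invGammaLaw ν ≠ ⊤ := by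
  have hm : Measurable fun z : ℝ =>
      ENNReal.ofReal (if 0 < z then z ^ (ν - 1 / 2) else 0) :=
    (Measurable.ite measurableSet_Ioi (by fun_prop) (by fun_prop)).ennreal_ofReal
  rw [invGammaLaw, lintegral_map hm (by fun_prop), gammaMeasure,
    lintegral_withDensity_eq_lintegral_mul _
      (show Measurable (gammaPDF ν 1) from (measurable_gammaPDFReal ν 1).ennreal_ofReal)
      (show Measurable fun x : ℝ => ENNReal.ofReal
        (if 0 < 1 / (2 * x) then (1 / (2 * x)) ^ (ν - 1 / 2) else 0) from
        hm.comp (by fun_prop))]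
  have hG : IntegrableOn (fun x : ℝ => (2 ^ (ν - 1 / 2))⁻¹ * (Gamma ν)⁻¹ *
      (Real.exp (-x) * x ^ ((1 / 2 : ℝ) - 1))) (Ioi 0) :=
    (Real.GammaIntegral_convergent (by norm_num)).const_mul _
  refine ne_of_lt (lt_of_le_of_lt ?_
    (((integrable_indicator_iff measurableSet_Ioi).2 hG).lintegral_lt_top))
  refine lintegral_mono fun x => ?_
  by_cases hx : 0 < x
  · have hz : 0 < 1 / (2 * x) := by positivity
    simp only [Pi.mul_apply, gammaPDF_of_nonneg hx.le, if_pos hz, indicator, mem_Ioi, if_pos hx]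
    rw [← ENNReal.ofReal_mul (by have := Gamma_pos_of_pos hν; positivity)]
    refine ENNReal.ofReal_le_ofReal (le_of_eq ?_)
    rw [one_div, Real.inv_rpow (by positivity), Real.mul_rpow (by norm_num) hx.le,
      Real.one_rpow, one_mul]
    have h1 : x ^ (ν - 1) = x ^ (ν - 1 / 2) * x ^ ((1 / 2 : ℝ) - 1) := by
      rw [← Real.rpow_add hx]; congr 1; ring
    have h2 : x ^ (ν - 1 / 2) ≠ 0 := (Real.rpow_pos_of_pos hx _).ne'
    rw [h1]
    field_simp
  · simp [hx]

/-- The square root of the tilted inverse-gamma variable, shifted to start at `0`, has finite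
mean. -/
theorem lintegral_sqrt_tiltedInvGamma_ne_top {ν c : ℝ} (hν : 0 < ν) (hc : 0 < c)
    [IsProbabilityMeasure (tiltedInvGamma ν c)] :
    ∫⁻ z, ENNReal.ofReal √(z / c - 1) ∂tiltedInvGamma ν c ≠ ⊤ := by
  set f : ℝ → ENNReal := fun z => ENNReal.ofReal (if c < z then (z - c) ^ (ν - 1) else 0)
    with hf
  have hfm : Measurable f :=
    (Measurable.ite measurableSet_Ioi (by fun_prop) (by fun_prop)).ennreal_ofReal
  set ρ := (invGammaLaw ν).withDensity f with hρ
  have htilt : tiltedInvGamma ν c = (ρ univ)⁻¹ • ρ := rfl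
  have hone : (ρ univ)⁻¹ * ρ univ = 1 := by
    simpa [htilt] using measure_univ (μ := tiltedInvGamma ν c)
  have hN0 : ρ univ ≠ 0 := fun h => by simp [h] at hone
  have hNtop : ρ univ ≠ ⊤ := fun h => by simp [h] at hone
  rw [htilt, lintegral_smul_measure, smul_eq_mul]
  refine ENNReal.mul_ne_top (ENNReal.inv_ne_top.2 hN0) ?_
  have hsm : Measurable fun z : ℝ => ENNReal.ofReal √(z / c - 1) := by fun_prop
  rw [hρ, lintegral_withDensity_eq_lintegral_mul _ hfm hsm]
  set q := ν - 1 / 2 with hq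
  set K : ℝ := (1 + (2 ^ q)⁻¹) * (√c)⁻¹ with hK
  have hbound : ∀ z, (f * fun z => ENNReal.ofReal √(z / c - 1)) z ≤
      f z + ENNReal.ofReal K * ENNReal.ofReal (if 0 < z then z ^ q else 0) := by
    intro z
    simp only [Pi.mul_apply]
    by_cases hcz : c < z
    swap
    · simp [hf, hcz]
    by_cases hz2 : z ≤ 2 * c
    · refine le_add_right (mul_le_of_le_one_right' ?_)
      rw [ENNReal.ofReal_le_one, Real.sqrt_le_one, sub_le_iff_le_add, div_le_iff₀ hc]
      linarith
    · refine le_add_left ?_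
      push Not at hz2
      have hz0 : 0 < z := hc.trans hcz
      have hzc : 0 < z - c := sub_pos.2 hcz
      simp only [hf, if_pos hcz, if_pos hz0]
      rw [← ENNReal.ofReal_mul (by positivity), ← ENNReal.ofReal_mul (by positivity)]
      refine ENNReal.ofReal_le_ofReal ?_
      have hdiv : z / c - 1 = (z - c) / c := by field_simp
      have hlhs : (z - c) ^ (ν - 1) * √(z / c - 1) = (z - c) ^ q * (√c)⁻¹ := by
        rw [hdiv, Real.sqrt_div hzc.le, Real.sqrt_eq_rpow (z - c), div_eq_mul_inv, ← mul_assoc,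
          ← Real.rpow_add hzc]
        congr 2
        rw [hq]; ring
      have hpow : (z - c) ^ q ≤ (1 + (2 ^ q)⁻¹) * z ^ q := by
        have hzq : 0 < z ^ q := Real.rpow_pos_of_pos hz0 q
        have h2q : (0 : ℝ) < (2 ^ q)⁻¹ := by positivity
        rcases le_total 0 q with h0 | h0
        · have := Real.rpow_le_rpow hzc.le (by linarith : z - c ≤ z) h0
          nlinarith
        · have := Real.rpow_le_rpow_of_nonpos (by linarith : 0 < z / 2)
            (by linarith : z / 2 ≤ z - c) h0
          rw [Real.div_rpow hz0.le (by norm_num), div_eq_mul_inv] at this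
          nlinarith
      rw [hlhs, hK]
      calc (z - c) ^ q * (√c)⁻¹ ≤ ((1 + (2 ^ q)⁻¹) * z ^ q) * (√c)⁻¹ := by gcongr
        _ = _ := by ring
  refine ne_top_of_le_ne_top ?_ (lintegral_mono hbound)
  rw [lintegral_add_left hfm, lintegral_const_mul' _ _ ENNReal.ofReal_ne_top]
  refine ENNReal.add_ne_top.2 ⟨?_, ENNReal.mul_ne_top ENNReal.ofReal_ne_top
    (lintegral_rpow_invGammaLaw_ne_top hν)⟩
  rwa [hρ, withDensity_apply _ MeasurableSet.univ, setLIntegral_univ] at hNtop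

/-- The tilted inverse-gamma law is carried by `(α, ∞)`. -/
theorem ae_lt_tiltedInvGamma (ν α : ℝ) : ∀ᵐ z ∂tiltedInvGamma ν α, α < z := by
  refine Measure.ae_smul_measure ?_ _
  have hm : Measurable fun z : ℝ =>
      ENNReal.ofReal (if α < z then (z - α) ^ (ν - 1) else 0) :=
    (Measurable.ite measurableSet_Ioi (by fun_prop) (by fun_prop)).ennreal_ofReal
  rw [ae_withDensity_iff hm]
  refine Filter.Eventually.of_forall fun z hz => ?_
  by_contra h
  simp [h] at hz

theorem stmt12 {Ω : Type*} [MeasurableSpace Ω] (P : Measure Ω) [IsProbabilityMeasure P]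
    (ν b c : ℝ) (hν : 0 < ν) (hc : 0 < c) (hcb : c < b)
    (Zb Zc Y₁ Y₂ : Ω → ℝ) (hZbm : Measurable Zb) (hZcm : Measurable Zc)
    (hY₁m : Measurable Y₁) (hY₂m : Measurable Y₂)
    (hZb : Measure.map Zb P = tiltedInvGamma ν b)
    (hZc : Measure.map Zc P = tiltedInvGamma ν c)
    (hY₁ : ∀ᵐ ω ∂P, Y₁ ω ∈ Set.Ioc (0:ℝ) 1)
    (hY₂ : ∀ᵐ ω ∂P, Y₂ ω ∈ Set.Ioc (0:ℝ) 1)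
    (hind₁ : IndepFun Y₁ Zc P) (hind₂ : IndepFun Y₂ Zc P)
    (hlaw₁ : Measure.map (fun ω => Zb ω / b - 1) P
           = Measure.map (fun ω => Y₁ ω * (Zc ω / c - 1)) P)
    (hlaw₂ : Measure.map (fun ω => Zb ω / b - 1) P
           = Measure.map (fun ω => Y₂ ω * (Zc ω / c - 1)) P) :
    Measure.map Y₁ P = Measure.map Y₂ P := by
  have hXm : Measurable fun ω => Zc ω / c - 1 := by fun_prop
  have hprob : IsProbabilityMeasure (tiltedInvGamma ν c) :=
    hZc ▸ Measure.isProbabilityMeasure_map hZcm.aemeasurable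
  have hXpos : ∀ᵐ ω ∂P, 0 < Zc ω / c - 1 := by
    have h := ae_lt_tiltedInvGamma ν c
    rw [← hZc] at h
    filter_upwards [ae_of_ae_map hZcm.aemeasurable h] with ω hω
    rwa [sub_pos, one_lt_div hc]
  set L : Ω → ℝ := fun ω => Real.log (Zc ω / c - 1) with hL
  have hLm : Measurable L := hXm.log
  have hint : Integrable (fun ω => Real.exp (1 / 2 * L ω)) P := by
    refine ⟨by fun_prop, ?_⟩
    rw [hasFiniteIntegral_iff_ofReal (Filter.Eventually.of_forall fun ω => (Real.exp_pos _).le)]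
    have h := lintegral_sqrt_tiltedInvGamma_ne_top hν hc
    rw [← hZc, lintegral_map (by fun_prop) hZcm] at h
    refine lt_of_le_of_lt (lintegral_mono_ae ?_) (lt_top_iff_ne_top.2 h)
    filter_upwards [hXpos] with ω hω
    refine ENNReal.ofReal_le_ofReal (le_of_eq ?_)
    rw [Real.sqrt_eq_rpow, Real.rpow_def_of_pos hω, mul_comm]
  have hmem : ∀ s ∈ Ioo (0 : ℝ) (1 / 2), Integrable (fun ω => Real.exp (s * L ω)) P :=
    fun s hs => integrable_exp_mul_of_le_of_le (a := 0) (b := 1 / 2) (by simp) hint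
      hs.1.le hs.2.le
  have hmgf : ∀ Y : Ω → ℝ, Measurable Y → (∀ᵐ ω ∂P, Y ω ∈ Ioc (0 : ℝ) 1) → IndepFun Y Zc P →
      ∀ s, mgf (fun ω => Real.log (Y ω)) P s * mgf L P s
        = mgf Real.log (P.map fun ω => Y ω * (Zc ω / c - 1)) s := by
    intro Y hYm hY hind s
    have hI : IndepFun (fun ω => Real.log (Y ω)) L P :=
      hind.comp (φ := Real.log) (ψ := fun z => Real.log (z / c - 1)) Real.measurable_log
        (by fun_prop)
    rw [← hI.mgf_add ((hYm.log.const_mul s).exp.aestronglyMeasurable)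
        ((hLm.const_mul s).exp.aestronglyMeasurable), mgf, mgf,
      integral_map (by fun_prop) (by fun_prop)]
    refine integral_congr_ae ?_
    filter_upwards [hY, hXpos] with ω h1 h2
    simp only [Pi.add_apply, hL]
    rw [Real.log_mul h1.1.ne' h2.ne']
  have hlog : P.map (fun ω => Real.log (Y₁ ω)) = P.map (fun ω => Real.log (Y₂ ω)) := by
    refine map_eq_map_of_mgf_eqOn_Ioo (by fun_prop) (by fun_prop) ?_ ?_
      (by norm_num : (0 : ℝ) < 1 / 2) fun s hs => ?_
    · filter_upwards [hY₁] with ω h using Real.log_nonpos h.1.le h.2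
    · filter_upwards [hY₂] with ω h using Real.log_nonpos h.1.le h.2
    · refine mul_right_cancel₀ (mgf_pos (hmem s hs)).ne' ?_
      rw [hmgf Y₁ hY₁m hY₁ hind₁, hmgf Y₂ hY₂m hY₂ hind₂, ← hlaw₁, ← hlaw₂]
  have hexp : ∀ Y : Ω → ℝ, Measurable Y → (∀ᵐ ω ∂P, Y ω ∈ Ioc (0 : ℝ) 1) →
      P.map Y = (P.map fun ω => Real.log (Y ω)).map Real.exp := by
    intro Y hYm hY
    rw [Measure.map_map Real.measurable_exp (by fun_prop)]
    refine Measure.map_congr ?_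
    filter_upwards [hY] with ω h using (Real.exp_log h.1).symm
  rw [hexp Y₁ hY₁m hY₁, hexp Y₂ hY₂m hY₂, hlog]
end
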